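/- arXiv:math/9909179 — 2 statements merged into one kernel-verified Lean document; each statement's English description precedes it below -/
import Mathlib

section
/- For every c ∈ ℂ with Re(c) > 0 and every τ ∈ S_c, the Mehler kernel is square integrable: ∫_ℝ ∫_ℝ |K_c(τ, x, y)|² dx dy < ∞. Consequently the integral operator A_{c,τ} f(x) := ∫_ℝ K_c(τ, x, y) f(y) dy is a Hilbert–Schmidt (in particular compact) operator on L²(ℝ). -/
open Complex MeasureTheory

/-- The maximal sector `S_c` of the bounded holomorphic semigroup generated by `-H_c`. -/
noncomputable def sector (c : ℂ) : Set ℂ :=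
  if 0 < c.im then
    {τ : ℂ | τ ≠ 0 ∧ -(Real.pi / 2) ≤ τ.arg ∧ τ.arg ≤ Real.pi / 2 - c.arg}
  else if c.im = 0 then
    {τ : ℂ | τ ≠ 0 ∧ -(Real.pi / 2) < τ.arg ∧ τ.arg < Real.pi / 2}
  else
    {τ : ℂ | τ ≠ 0 ∧ -(Real.pi / 2) - c.arg ≤ τ.arg ∧ τ.arg ≤ Real.pi / 2}

/-- `λ = exp(-2 c^{1/2} τ)`. -/
noncomputable def lam (c τ : ℂ) : ℂ := Complex.exp (-2 * c ^ ((1 : ℂ) / 2) * τ)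

/-- `w₁ = c^{1/4} λ^{1/2} (π (1 - λ²))^{-1/2}`. -/
noncomputable def w₁ (c τ : ℂ) : ℂ :=
  c ^ ((1 : ℂ) / 4) * lam c τ ^ ((1 : ℂ) / 2) *
    ((Real.pi : ℂ) * (1 - lam c τ ^ 2)) ^ (-(1 : ℂ) / 2)

/-- `w₂ = c^{1/2} (1 + λ²) / (2 (1 - λ²))`. -/
noncomputable def w₂ (c τ : ℂ) : ℂ :=
  c ^ ((1 : ℂ) / 2) * (1 + lam c τ ^ 2) / (2 * (1 - lam c τ ^ 2))

/-- `w₃ = 2 c^{1/2} λ / (1 - λ²)`. -/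
noncomputable def w₃ (c τ : ℂ) : ℂ :=
  2 * c ^ ((1 : ℂ) / 2) * lam c τ / (1 - lam c τ ^ 2)

/-- The Mehler kernel `K_c(τ, x, y) = w₁ exp(w₃ x y - w₂ (x² + y²))`. -/
noncomputable def mehlerK (c τ : ℂ) (x y : ℝ) : ℂ :=
  w₁ c τ * Complex.exp (w₃ c τ * (x : ℂ) * (y : ℂ) - w₂ c τ * ((x : ℂ) ^ 2 + (y : ℂ) ^ 2))

open scoped InnerProductSpace in
/-- A Hilbert–Schmidt operator is compact. -/
theorem HilbertBasis.isCompactOperator_of_summable {ι 𝕜 E F : Type*} [RCLike 𝕜]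
    [NormedAddCommGroup E] [InnerProductSpace 𝕜 E]
    [NormedAddCommGroup F] [NormedSpace 𝕜 F] [CompleteSpace F]
    (b : HilbertBasis ι 𝕜 E) (T : E →L[𝕜] F) (hT : Summable fun i => ‖T (b i)‖ ^ 2) :
    IsCompactOperator T := by
  classical
  let S : Finset ι → E →L[𝕜] F := fun s =>
    ∑ i ∈ s, (innerSL 𝕜 (b i)).smulRight (T (b i))
  have hSapply (s : Finset ι) (x : E) : S s x = ∑ i ∈ s, ⟪b i, x⟫_𝕜 • T (b i) := by
    simp [S]
  have hS (s : Finset ι) : IsCompactOperator (S s) := by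
    refine (compactOperator (RingHom.id 𝕜) E F).sum_mem fun i _ => ?_
    exact (isCompactOperator_of_locallyCompactSpace_dom (innerSL 𝕜 (b i))).clm_comp
      (ContinuousLinearMap.toSpanSingleton 𝕜 (T (b i)))
  refine isCompactOperator_of_tendsto (F := S) (l := Filter.atTop) ?_ (.of_forall hS)
  rw [Metric.tendsto_atTop]
  intro ε hε
  obtain ⟨s, hs⟩ := summable_iff_vanishing_norm.mp hT ((ε / 2) ^ 2) (by positivity)
  refine ⟨s, fun t hst => ?_⟩
  rw [dist_comm, dist_eq_norm]
  refine lt_of_le_of_lt (ContinuousLinearMap.opNorm_le_bound _ (half_pos hε).le fun x => ?_)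
    (half_lt_self hε)
  have hsum : HasSum (fun i => ⟪b i, x⟫_𝕜 • T (b i)) (T x) := by
    simpa [b.repr_apply_apply] using (b.hasSum_repr x).mapL T
  refine le_of_tendsto (hsum.sub_const (S t x)).norm
    (Filter.eventually_atTop.mpr ⟨t, fun u htu => ?_⟩)
  have hdiff : ∑ i ∈ u, ⟪b i, x⟫_𝕜 • T (b i) - S t x
      = ∑ i ∈ u \ t, ⟪b i, x⟫_𝕜 • T (b i) := by
    rw [hSapply, ← Finset.sum_sdiff htu, add_sub_cancel_right]
  rw [hdiff]
  have htail : ∑ i ∈ u \ t, ‖T (b i)‖ ^ 2 ≤ (ε / 2) ^ 2 :=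
    (le_abs_self _).trans
      (hs (u \ t) (Finset.disjoint_of_subset_right hst Finset.sdiff_disjoint)).le
  calc ‖∑ i ∈ u \ t, ⟪b i, x⟫_𝕜 • T (b i)‖
      ≤ ∑ i ∈ u \ t, ‖T (b i)‖ * ‖⟪b i, x⟫_𝕜‖ :=
        norm_sum_le_of_le _ fun i _ => by rw [norm_smul, mul_comm]
    _ ≤ √(∑ i ∈ u \ t, ‖T (b i)‖ ^ 2) * √(∑ i ∈ u \ t, ‖⟪b i, x⟫_𝕜‖ ^ 2) :=
        Real.sum_mul_le_sqrt_mul_sqrt _ _ _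
    _ ≤ √((ε / 2) ^ 2) * √(‖x‖ ^ 2) := by
        gcongr
        exact b.orthonormal.sum_inner_products_le x
    _ = ε / 2 * ‖x‖ := by
        rw [Real.sqrt_sq (by positivity), Real.sqrt_sq (norm_nonneg x)]

open scoped InnerProductSpace in
/-- A Carleman operator `f ↦ (x ↦ ⟪φ x, f⟫)` whose kernel `φ` has square integrable norm is
compact into `L²`. -/
theorem exists_isCompactOperator_inner {α 𝕜 E : Type*} [RCLike 𝕜] {_ : MeasurableSpace α}
    {μ : Measure α} [NormedAddCommGroup E] [InnerProductSpace 𝕜 E] [CompleteSpace E]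
    (φ : α → E) (hmeas : ∀ f : E, AEStronglyMeasurable (fun x => ⟪φ x, f⟫_𝕜) μ)
    (hφ : MemLp (fun x => ‖φ x‖) 2 μ) :
    ∃ T : E →L[𝕜] Lp 𝕜 2 μ, IsCompactOperator T ∧
      ∀ f : E, (T f : α → 𝕜) =ᵐ[μ] fun x => ⟪φ x, f⟫_𝕜 := by
  have hmem (f : E) : MemLp (fun x => ⟪φ x, f⟫_𝕜) 2 μ :=
    hφ.of_le_mul (c := ‖f‖) (hmeas f) <| .of_forall fun x => by
      rw [norm_norm, mul_comm]; exact norm_inner_le_norm _ _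
  let T₀ : E →ₗ[𝕜] Lp 𝕜 2 μ :=
    { toFun := fun f => (hmem f).toLp
      map_add' := fun f g => by
        rw [← MemLp.toLp_add]
        exact MemLp.toLp_congr _ _ (.of_forall fun x => inner_add_right _ _ _)
      map_smul' := fun a f => by
        rw [RingHom.id_apply, ← MemLp.toLp_const_smul]
        exact MemLp.toLp_congr _ _ (.of_forall fun x => inner_smul_right _ _ _) }
  let T : E →L[𝕜] Lp 𝕜 2 μ := T₀.mkContinuous ‖hφ.toLp‖ fun f => by
    rw [mul_comm]
    refine Lp.norm_le_mul_norm_of_ae_le_mul ?_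
    filter_upwards [(hmem f).coeFn_toLp, hφ.coeFn_toLp] with x h1 h2
    rw [h2, norm_norm, mul_comm]
    exact (congrArg norm h1).trans_le (norm_inner_le_norm _ _)
  have hT (f : E) : (T f : α → 𝕜) =ᵐ[μ] fun x => ⟪φ x, f⟫_𝕜 := (hmem f).coeFn_toLp
  refine ⟨T, ?_, hT⟩
  obtain ⟨w, b, -⟩ := exists_hilbertBasis 𝕜 E
  refine b.isCompactOperator_of_summable T
    (summable_of_sum_le (c := ∫ x, ‖φ x‖ ^ 2 ∂μ) (fun i => by positivity) fun s => ?_)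
  have hnorm (f : E) : ‖T f‖ ^ 2 = ∫ x, ‖⟪φ x, f⟫_𝕜‖ ^ 2 ∂μ := by
    rw [@norm_sq_eq_re_inner 𝕜, L2.inner_def, ← integral_re (L2.integrable_inner _ _)]
    refine integral_congr_ae ?_
    filter_upwards [hT f] with x hx
    rw [hx, ← norm_sq_eq_re_inner]
  have hint (f : E) : Integrable (fun x => ‖⟪φ x, f⟫_𝕜‖ ^ 2) μ := (hmem f).norm.integrable_sq
  simp_rw [hnorm]
  rw [← integral_finsetSum _ fun i _ => hint (b i)]
  refine integral_mono (integrable_finsetSum _ fun i _ => hint (b i)) hφ.integrable_sq fun x => ?_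
  simpa only [norm_inner_symm] using b.orthonormal.sum_inner_products_le (φ x) (s := s)

/-- An integral operator with square integrable kernel is compact on `L²`. -/
theorem exists_isCompactOperator_integral_mul {α β 𝕜 : Type*} [RCLike 𝕜]
    {_ : MeasurableSpace α} {_ : MeasurableSpace β} {μ : Measure α} {ν : Measure β}
    [SFinite μ] [SFinite ν] {K : α → β → 𝕜}
    (hK : MemLp (Function.uncurry K) 2 (μ.prod ν)) :
    ∃ T : Lp 𝕜 2 ν →L[𝕜] Lp 𝕜 2 μ, IsCompactOperator T ∧
      ∀ f : Lp 𝕜 2 ν, (T f : α → 𝕜) =ᵐ[μ] fun x => ∫ y, K x y * f y ∂ν := by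
  classical
  have hsq : Integrable (fun p : α × β => ‖K p.1 p.2‖ ^ 2) (μ.prod ν) := hK.norm.integrable_sq
  have hsec : ∀ᵐ x ∂μ, MemLp (fun y => star (K x y)) 2 ν := by
    filter_upwards [hsq.prod_right_ae, hK.1.prodMk_left] with x hx hm
    exact MemLp.star ((memLp_two_iff_integrable_sq_norm hm).mpr hx)
  let φ : α → Lp 𝕜 2 ν := fun x => if h : MemLp (fun y => star (K x y)) 2 ν then h.toLp else 0
  have hφ : ∀ᵐ x ∂μ, φ x =ᵐ[ν] fun y => star (K x y) := by
    filter_upwards [hsec] with x hx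
    simpa only [φ, dif_pos hx] using hx.coeFn_toLp
  have hinner (f : Lp 𝕜 2 ν) :
      (fun x => inner 𝕜 (φ x) f) =ᵐ[μ] fun x => ∫ y, K x y * f y ∂ν := by
    filter_upwards [hφ] with x hx
    rw [L2.inner_def]
    refine integral_congr_ae ?_
    filter_upwards [hx] with y hy
    simp [hy, mul_comm]
  have hnorm : (fun x => ‖φ x‖ ^ 2) =ᵐ[μ] fun x => ∫ y, ‖K x y‖ ^ 2 ∂ν := by
    filter_upwards [hφ] with x hx
    rw [@norm_sq_eq_re_inner 𝕜, L2.inner_def, ← integral_re (L2.integrable_inner _ _)]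
    refine integral_congr_ae ?_
    filter_upwards [hx] with y hy
    rw [← norm_sq_eq_re_inner, hy, norm_star]
  have hsqφ : Integrable (fun x => ‖φ x‖ ^ 2) μ := hsq.integral_prod_left.congr hnorm.symm
  obtain ⟨T, hT, hTf⟩ := exists_isCompactOperator_inner (𝕜 := 𝕜) φ
    (fun f => by
      refine AEStronglyMeasurable.congr ?_ (hinner f).symm
      exact (hK.1.mul (Lp.aestronglyMeasurable f).comp_snd).integral_prod_right')
    ((memLp_two_iff_integrable_sq
      (by simpa using hsqφ.1.aemeasurable.sqrt.aestronglyMeasurable)).mpr hsqφ)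
  exact ⟨T, hT, fun f => (hTf f).trans (hinner f)⟩

theorem re_mul_eq_norm_mul_cos_arg (z w : ℂ) :
    (z * w).re = ‖z‖ * ‖w‖ * Real.cos (z.arg + w.arg) := by
  rw [Real.cos_add, mul_re, ← norm_mul_cos_arg z, ← norm_mul_cos_arg w, ← norm_mul_sin_arg z,
    ← norm_mul_sin_arg w]
  ring

theorem re_nonneg_of_mem_sector {c τ : ℂ} (hc : 0 < c.re) (hτ : τ ∈ sector c) :
    0 ≤ τ.re ∧ 0 ≤ (c * τ).re := by
  have h := abs_lt.mp (abs_arg_lt_pi_div_two_iff.mpr (Or.inl hc))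
  have hτ' : -(Real.pi / 2) ≤ τ.arg ∧ τ.arg ≤ Real.pi / 2 ∧
      -(Real.pi / 2) ≤ c.arg + τ.arg ∧ c.arg + τ.arg ≤ Real.pi / 2 := by
    unfold sector at hτ
    split_ifs at hτ with h1 h2
    · have := arg_nonneg_iff.mpr h1.le
      obtain ⟨-, h3, h4⟩ := hτ
      refine ⟨?_, ?_, ?_, ?_⟩ <;> linarith
    · have := arg_eq_zero_iff.mpr ⟨hc.le, h2⟩
      obtain ⟨-, h3, h4⟩ := hτ
      refine ⟨?_, ?_, ?_, ?_⟩ <;> linarith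
    · have := arg_neg_iff.mpr (lt_of_le_of_ne (not_lt.mp h1) h2)
      obtain ⟨-, h3, h4⟩ := hτ
      refine ⟨?_, ?_, ?_, ?_⟩ <;> linarith
  refine ⟨?_, ?_⟩
  · rw [← norm_mul_cos_arg]
    exact mul_nonneg (norm_nonneg _) (Real.cos_nonneg_of_neg_pi_div_two_le_of_le hτ'.1 hτ'.2.1)
  · rw [re_mul_eq_norm_mul_cos_arg]
    exact mul_nonneg (by positivity)
      (Real.cos_nonneg_of_neg_pi_div_two_le_of_le hτ'.2.2.1 hτ'.2.2.2)

theorem ne_zero_of_mem_sector {c τ : ℂ} (hτ : τ ∈ sector c) : τ ≠ 0 := by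
  unfold sector at hτ
  split_ifs at hτ <;> exact hτ.1

theorem re_pos_of_mem_sector_of_im_eq_zero {c τ : ℂ} (hc : c.im = 0) (hτ : τ ∈ sector c) :
    0 < τ.re := by
  simp only [sector, hc, lt_irrefl, if_false, if_true, Set.mem_ofPred_eq] at hτ
  exact (abs_arg_lt_pi_div_two_iff.mp (abs_lt.mpr hτ.2)).resolve_right hτ.1

/-- With `s` the principal square root of `c`, the point `s τ` lies in the closed cone
`|Im s| |Im z| ≤ Re s Re z` and in the open right half plane. -/
theorem sqrt_mul_mem_cone {c s τ : ℂ} (hc : 0 < c.re) (hs : 0 < s.re) (hsc : s ^ 2 = c)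
    (hτ : τ ∈ sector c) :
    0 < (s * τ).re ∧ |s.im * (s * τ).im| ≤ s.re * (s * τ).re := by
  obtain ⟨h1, h2⟩ := re_nonneg_of_mem_sector hc hτ
  have h3 : s.re * (s * τ).re - s.im * (s * τ).im = (c * τ).re := by
    rw [← hsc, pow_two, mul_assoc, ← mul_re]
  have h4 : s.re * (s * τ).re + s.im * (s * τ).im = (s.re ^ 2 + s.im ^ 2) * τ.re := by
    simp only [mul_re, mul_im]; ring
  have h5 : 0 ≤ (s.re ^ 2 + s.im ^ 2) * τ.re := by positivity
  have habs : |s.im * (s * τ).im| ≤ s.re * (s * τ).re := abs_le.mpr ⟨by linarith, by linarith⟩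
  refine ⟨?_, habs⟩
  have h0 : 0 ≤ (s * τ).re := nonneg_of_mul_nonneg_right ((abs_nonneg _).trans habs) hs
  refine h0.lt_of_ne fun hz => ?_
  by_cases hq : s.im = 0
  · have hcim : c.im = 0 := by rw [← hsc, pow_two, mul_im, hq]; ring
    have := mul_pos hs (re_pos_of_mem_sector_of_im_eq_zero hcim hτ)
    rw [mul_re, hq] at hz
    linarith
  · rw [← hz, mul_zero, abs_nonpos_iff] at habs
    have him : (s * τ).im = 0 := (mul_eq_zero.mp habs).resolve_left hq
    rcases mul_eq_zero.mp (Complex.ext hz.symm him : s * τ = 0) with h | h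
    · simp [h] at hs
    · exact ne_zero_of_mem_sector hτ h

theorem abs_mul_sin_lt_mul_sinh {p q a b : ℝ} (hp : 0 < p) (ha : 0 < a)
    (h : |q * b| ≤ p * a) : |q * Real.sin (2 * b)| < p * Real.sinh (2 * a) := by
  calc |q * Real.sin (2 * b)| ≤ |q| * |2 * b| := by
        rw [abs_mul]; exact mul_le_mul_of_nonneg_left Real.abs_sin_le_abs (abs_nonneg q)
    _ = 2 * |q * b| := by rw [abs_mul, abs_mul, abs_two]; ring
    _ ≤ p * (2 * a) := by linarith
    _ < p * Real.sinh (2 * a) := by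
        gcongr; exact Real.self_lt_sinh_iff.mpr (by linarith)

theorem re_mul_one_add_div_one_sub_pos {s z l : ℂ} (hs : 0 < s.re) (hz : 0 < z.re)
    (hl : l = exp (-2 * z)) (h : |s.im * z.im| ≤ s.re * z.re) :
    0 < (s * ((1 + l) / (1 - l))).re ∧ 0 < (s * ((1 - l) / (1 + l))).re := by
  have hlt : ‖l‖ < 1 := by
    rw [hl, norm_exp, Real.exp_lt_one_iff]; simpa using hz
  have hn1 : 0 < normSq (1 - l) := by
    rw [normSq_pos, sub_ne_zero]; rintro rfl; simp at hlt
  have hn2 : 0 < normSq (1 + l) := by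
    rw [normSq_pos]; intro h0
    rw [← neg_eq_of_add_eq_zero_right h0] at hlt; simp at hlt
  have hlr : l.re = Real.exp (-2 * z.re) * Real.cos (2 * z.im) := by
    rw [hl, exp_re]; simp
  have hli : l.im = -(Real.exp (-2 * z.re) * Real.sin (2 * z.im)) := by
    rw [hl, exp_im]; simp
  have hexp := Real.exp_pos (-2 * z.re)
  have key := abs_lt.mp (abs_mul_sin_lt_mul_sinh hs hz h)
  have hnorm : l.re ^ 2 + l.im ^ 2 = Real.exp (-2 * z.re) ^ 2 := by
    rw [hlr, hli]
    linear_combination Real.exp (-2 * z.re) ^ 2 * Real.sin_sq_add_cos_sq (2 * z.im)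
  have hsinh : 2 * Real.exp (-2 * z.re) * Real.sinh (2 * z.re)
      = 1 - Real.exp (-2 * z.re) ^ 2 := by
    have : Real.exp (-2 * z.re) * Real.exp (2 * z.re) = 1 := by
      rw [← Real.exp_add]; simp
    rw [Real.sinh_eq, ← neg_mul]
    linear_combination this
  clear hl h
  generalize Real.exp (-2 * z.re) = r at *
  have e1 : (s * ((1 + l) / (1 - l))).re
      = 2 * r * (s.re * Real.sinh (2 * z.re) + s.im * Real.sin (2 * z.im))
        / normSq (1 - l) := by
    simp only [mul_re, div_re, div_im, add_re, add_im, sub_re, sub_im, one_re, one_im]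
    field_simp
    linear_combination -s.re * hnorm - s.re * hsinh - 2 * s.im * hli
  have e2 : (s * ((1 - l) / (1 + l))).re
      = 2 * r * (s.re * Real.sinh (2 * z.re) - s.im * Real.sin (2 * z.im))
        / normSq (1 + l) := by
    simp only [mul_re, div_re, div_im, add_re, add_im, sub_re, sub_im, one_re, one_im]
    field_simp
    linear_combination -s.re * hnorm - s.re * hsinh + 2 * s.im * hli
  rw [e1, e2]
  exact ⟨div_pos (mul_pos (by positivity) (by linarith)) hn1,
    div_pos (mul_pos (by positivity) (by linarith)) hn2⟩

theorem integrable_norm_sq_exp_quadratic {C P Q : ℂ} (hP : 0 < P.re) (hQ : 0 < Q.re) :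
    Integrable (fun p : ℝ × ℝ => ‖C * exp ((P - Q) / 2 * (p.1 : ℂ) * (p.2 : ℂ)
      - (P + Q) / 4 * ((p.1 : ℂ) ^ 2 + (p.2 : ℂ) ^ 2))‖ ^ 2) := by
  have hm : 0 < min P.re Q.re := lt_min hP hQ
  have hg := ((integrable_exp_neg_mul_sq hm).mul_prod (integrable_exp_neg_mul_sq hm)).const_mul
    (‖C‖ ^ 2)
  refine hg.mono' (by fun_prop) (.of_forall fun ⟨x, y⟩ => ?_)
  have hre : ((P - Q) / 2 * (x : ℂ) * (y : ℂ) - (P + Q) / 4 * ((x : ℂ) ^ 2 + (y : ℂ) ^ 2)).re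
      = -(P.re / 4 * (x - y) ^ 2 + Q.re / 4 * (x + y) ^ 2) := by
    have : (P - Q) / 2 * (x : ℂ) * (y : ℂ) - (P + Q) / 4 * ((x : ℂ) ^ 2 + (y : ℂ) ^ 2)
        = -(((x - y) ^ 2 / 4 : ℝ) * P + ((x + y) ^ 2 / 4 : ℝ) * Q) := by
      push_cast; ring
    rw [this, neg_re, add_re, re_ofReal_mul, re_ofReal_mul]
    ring
  rw [norm_pow, norm_norm, norm_mul, norm_exp, hre, mul_pow, ← Real.exp_nat_mul, ← Real.exp_add]
  gcongr
  push_cast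
  nlinarith [mul_le_mul_of_nonneg_right (min_le_left P.re Q.re) (sq_nonneg (x - y)),
    mul_le_mul_of_nonneg_right (min_le_right P.re Q.re) (sq_nonneg (x + y))]

theorem integrable_norm_mehlerK_sq {c τ : ℂ} (hc : 0 < c.re) (hτ : τ ∈ sector c) :
    Integrable (fun p : ℝ × ℝ => ‖mehlerK c τ p.1 p.2‖ ^ 2) := by
  have hc0 : c ≠ 0 := by rintro rfl; simp at hc
  have hs : 0 < (c ^ ((1 : ℂ) / 2)).re := by
    have h := abs_lt.mp (abs_arg_lt_pi_div_two_iff.mpr (Or.inl hc))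
    rw [cpow_def_of_ne_zero hc0, exp_re]
    refine mul_pos (Real.exp_pos _) (Real.cos_pos_of_mem_Ioo ?_)
    have : (log c * ((1 : ℂ) / 2)).im = c.arg / 2 := by
      simp [mul_im, log_im, div_eq_mul_inv]
    rw [this]
    constructor <;> linarith [Real.pi_pos]
  have hsc : (c ^ ((1 : ℂ) / 2)) ^ 2 = c := by
    rw [one_div]; exact cpow_nat_inv_pow c two_ne_zero
  obtain ⟨hz, hcone⟩ := sqrt_mul_mem_cone hc hs hsc hτ
  have hl : lam c τ = exp (-2 * (c ^ ((1 : ℂ) / 2) * τ)) := by rw [lam, mul_assoc]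
  obtain ⟨hP, hQ⟩ := re_mul_one_add_div_one_sub_pos hs hz hl hcone
  have h1 : 1 - lam c τ ≠ 0 := fun h => by simp [h] at hP
  have h2 : 1 + lam c τ ≠ 0 := fun h => by simp [h] at hQ
  have h3 : 1 - lam c τ ^ 2 ≠ 0 := by
    rw [show 1 - lam c τ ^ 2 = (1 - lam c τ) * (1 + lam c τ) by ring]
    exact mul_ne_zero h1 h2
  have hw₂ : w₂ c τ = (c ^ ((1 : ℂ) / 2) * ((1 + lam c τ) / (1 - lam c τ))
      + c ^ ((1 : ℂ) / 2) * ((1 - lam c τ) / (1 + lam c τ))) / 4 := by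
    rw [w₂]
    field_simp
    ring
  have hw₃ : w₃ c τ = (c ^ ((1 : ℂ) / 2) * ((1 + lam c τ) / (1 - lam c τ))
      - c ^ ((1 : ℂ) / 2) * ((1 - lam c τ) / (1 + lam c τ))) / 2 := by
    rw [w₃]
    field_simp
    ring
  simp only [mehlerK, hw₂, hw₃]
  exact integrable_norm_sq_exp_quadratic hP hQ

/-- The Mehler kernel is square integrable on `ℝ²`, and consequently the integral
operator `A_{c,τ} f(x) = ∫ K_c(τ,x,y) f(y) dy` defines a Hilbert–Schmidt — in
particular compact — operator on `L²(ℝ)`. -/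
theorem mehlerK_hilbertSchmidt (c : ℂ) (hc : 0 < c.re) (τ : ℂ) (hτ : τ ∈ sector c) :
    Integrable (fun p : ℝ × ℝ => ‖mehlerK c τ p.1 p.2‖ ^ 2)
      (volume : Measure (ℝ × ℝ)) ∧
    ∃ T : Lp ℂ 2 (volume : Measure ℝ) →L[ℂ] Lp ℂ 2 (volume : Measure ℝ),
      IsCompactOperator T ∧
      ∀ f : Lp ℂ 2 (volume : Measure ℝ),
        (T f : ℝ → ℂ) =ᵐ[volume] fun x : ℝ => ∫ y : ℝ, mehlerK c τ x y * f y := by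
  have h := integrable_norm_mehlerK_sq hc hτ
  refine ⟨h, exists_isCompactOperator_integral_mul (K := mehlerK c τ) ?_⟩
  refine (memLp_two_iff_integrable_sq_norm ?_).mpr h
  unfold Function.uncurry mehlerK
  fun_prop
end

section
/- Let c ∈ ℂ with Re(c) > 0 and Im(c) > 0. For every 0 < δ < 1 there exists ε > 0 such that for every z ∈ ℂ with z ∉ S(0, arg(c)) + δ c^{1/2} and every f ∈ 𝒮(ℝ): ‖H_c f − z f‖ ≥ ε ‖f‖. (Equivalently, the ε-pseudospectrum of H_c is contained in the translated sector S(0, arg(c)) + δ c^{1/2}; in particular it is contained in the numerical range of H_c for ε small enough.) -/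
open Complex MeasureTheory

/-- `‖H_c f - z f‖`, the `L²(ℝ)`-norm of the shifted complex harmonic oscillator
applied to `f`. -/
noncomputable def oscShiftedNorm (c z : ℂ) (f : ℝ → ℂ) : ℝ :=
  Real.sqrt (∫ x : ℝ, ‖-(deriv (deriv f) x) + c * (x : ℂ) ^ 2 * f x - z * f x‖ ^ 2)

/-- The `L²(ℝ)`-norm. -/
noncomputable def l2Norm (f : ℝ → ℂ) : ℝ :=
  Real.sqrt (∫ x : ℝ, ‖f x‖ ^ 2)

section Biorthogonal

variable {E : Type*} [NormedAddCommGroup E] [InnerProductSpace ℂ E] {e d : ℕ → E} {μ : ℕ → ℂ}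

/-- Dissipativity on the span of the `e i` makes the diagonal flow a contraction. -/
theorem norm_diagonal_flow_le
    (hdiss : ∀ (s : Finset ℕ) (a : ℕ → ℂ),
      (inner ℂ (∑ i ∈ s, a i • e i) (∑ i ∈ s, (a i * μ i) • e i)).re ≤ 0)
    (s : Finset ℕ) (b : ℕ → ℂ) {t : ℝ} (ht : 0 ≤ t) :
    ‖∑ i ∈ s, (b i * exp (μ i * t)) • e i‖ ≤ ‖∑ i ∈ s, b i • e i‖ := by
  set w : ℝ → E := fun t => ∑ i ∈ s, (b i * exp (μ i * t)) • e i with hw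
  let _ : InnerProductSpace ℝ E := InnerProductSpace.rclikeToReal ℂ E
  have hd (t : ℝ) : HasDerivAt w (∑ i ∈ s, (b i * exp (μ i * t) * μ i) • e i) t := by
    refine HasDerivAt.fun_sum fun i _ => HasDerivAt.smul_const ?_ _
    have h : HasDerivAt (fun t : ℝ => μ i * (t : ℂ)) (μ i) t := by
      simpa using (ofRealCLM.hasDerivAt (x := t)).const_mul (μ i)
    simpa [mul_assoc] using h.cexp.const_mul (b i)
  have hn (t : ℝ) := (hd t).norm_sq
  have hanti : Antitone fun t => ‖w t‖ ^ 2 := by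
    refine antitone_of_deriv_nonpos (fun t => (hn t).differentiableAt) fun t => ?_
    rw [(hn t).deriv]
    have := hdiss s fun i => b i * exp (μ i * t)
    rw [real_inner_eq_re_inner ℂ]
    simp only [hw, RCLike.re_eq_complex_re]
    linarith
  have h0 : w 0 = ∑ i ∈ s, b i • e i := by simp [hw]
  have := hanti ht
  simp only [h0] at this
  exact le_of_sq_le_sq this (norm_nonneg _)

/-- A dissipative diagonal operator whose spectral projections grow at most geometrically has a
resolvent that is uniformly bounded on every half-plane strictly to the right of its spectrum. -/
theorem exists_uniform_resolvent_bound {m C R δ : ℝ} (hm : 0 < m) (hδ0 : 0 < δ) (hδ : δ < 1)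
    (hC : 0 ≤ C) (hR : 0 ≤ R)
    (hμ : ∀ n, (μ n).re = -((2 * n + 1) * m))
    (horth : ∀ i j, i ≠ j → inner ℂ (d i) (e j) = 0) (hne : ∀ i, inner ℂ (d i) (e i) ≠ 0)
    (hproj : ∀ i, ‖d i‖ * ‖e i‖ ≤ C * R ^ i * ‖inner ℂ (d i) (e i)‖)
    (hdiss : ∀ (s : Finset ℕ) (a : ℕ → ℂ),
      (inner ℂ (∑ i ∈ s, a i • e i) (∑ i ∈ s, (a i * μ i) • e i)).re ≤ 0) :
    ∃ ε : ℝ, 0 < ε ∧ ∀ z : ℂ, -(δ * m) ≤ z.re → ∀ (s : Finset ℕ) (a : ℕ → ℂ),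
      ε * ‖∑ i ∈ s, a i • e i‖ ≤ ‖∑ i ∈ s, (a i * (μ i - z)) • e i‖ := by
  obtain ⟨T, hT0, hT1, hT2⟩ : ∃ T : ℝ, 0 < T ∧ R * Real.exp (-(2 * m * T)) ≤ 1 / 2 ∧
      2 * C * Real.exp (-((1 - δ) * m * T)) ≤ 1 / 2 := by
    have lim (k A : ℝ) (hk : 0 < k) :
        ∀ᶠ T : ℝ in Filter.atTop, A * Real.exp (-(k * T)) ≤ 1 / 2 := by
      have h := (Real.tendsto_exp_neg_atTop_nhds_zero.comp
        (Filter.tendsto_id.const_mul_atTop hk)).const_mul A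
      rw [mul_zero] at h
      exact h.eventually_le_const (by norm_num)
    have := ((Filter.eventually_gt_atTop (0 : ℝ)).and
      ((lim (2 * m) R (by positivity)).and
        (lim ((1 - δ) * m) (2 * C) (mul_pos (by linarith) hm)))).exists
    simpa using this
  set M := Real.exp (δ * m * T)
  refine ⟨1 / (2 * M * T), by positivity, fun z hz s a => ?_⟩
  set v := ∑ i ∈ s, a i • e i
  set g := ∑ i ∈ s, (a i * (μ i - z)) • e i
  set w : ℝ → E := fun t => ∑ i ∈ s, (a i * exp ((μ i - z) * t)) • e i with hw
  have hd (t : ℝ) : HasDerivAt w (∑ i ∈ s, (a i * (exp ((μ i - z) * t) * (μ i - z))) • e i) t := by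
    refine HasDerivAt.fun_sum fun i _ => HasDerivAt.smul_const ?_ _
    have h : HasDerivAt (fun t : ℝ => (μ i - z) * (t : ℂ)) (μ i - z) t := by
      simpa using (ofRealCLM.hasDerivAt (x := t)).const_mul (μ i - z)
    exact h.cexp.const_mul (a i)
  have hb (t : ℝ) (ht : t ∈ Set.Ico 0 T) :
      ‖∑ i ∈ s, (a i * (exp ((μ i - z) * t) * (μ i - z))) • e i‖ ≤ M * ‖g‖ := by
    have : ∑ i ∈ s, (a i * (exp ((μ i - z) * t) * (μ i - z))) • e i
        = exp (-z * t) • ∑ i ∈ s, (a i * (μ i - z) * exp (μ i * t)) • e i := by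
      rw [Finset.smul_sum]
      refine Finset.sum_congr rfl fun i _ => ?_
      rw [smul_smul, show (μ i - z) * (t : ℂ) = -z * t + μ i * t by ring, Complex.exp_add]
      congr 1; ring
    rw [this, norm_smul, norm_exp]
    gcongr
    · have : -z.re * t ≤ δ * m * T := by
        have := mul_nonneg hδ0.le hm.le
        nlinarith [ht.1, ht.2]
      simpa [M] using this
    · exact norm_diagonal_flow_le hdiss s _ ht.1
  have h1 := norm_image_sub_le_of_norm_deriv_le_segment' (fun t _ => (hd t).hasDerivWithinAt) hb
    T (Set.right_mem_Icc.2 hT0.le)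
  have hw0 : w 0 = v := by simp [hw, v]
  have hcoef (i : ℕ) (hi : i ∈ s) : ‖a i • e i‖ ≤ C * R ^ i * ‖v‖ := by
    have h : inner ℂ (d i) v = a i * inner ℂ (d i) (e i) := by
      simp only [v, inner_sum, inner_smul_right]
      refine Finset.sum_eq_single_of_mem i hi fun j _ hj => ?_
      rw [horth i j hj.symm, mul_zero]
    have h2 : ‖a i‖ * ‖inner ℂ (d i) (e i)‖ ≤ ‖d i‖ * ‖v‖ := by
      rw [← norm_mul, ← h]; exact norm_inner_le_norm _ _
    have h3 := norm_pos_iff.2 (hne i)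
    rw [norm_smul]
    refine le_of_mul_le_mul_right ?_ h3
    calc ‖a i‖ * ‖e i‖ * ‖inner ℂ (d i) (e i)‖ = ‖a i‖ * ‖inner ℂ (d i) (e i)‖ * ‖e i‖ := by ring
      _ ≤ ‖d i‖ * ‖v‖ * ‖e i‖ := by gcongr
      _ = ‖d i‖ * ‖e i‖ * ‖v‖ := by ring
      _ ≤ C * R ^ i * ‖inner ℂ (d i) (e i)‖ * ‖v‖ :=
          mul_le_mul_of_nonneg_right (hproj i) (norm_nonneg _)
      _ = _ := by ring
  have hwT : ‖w T‖ ≤ 1 / 2 * ‖v‖ := by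
    have hterm (i : ℕ) (hi : i ∈ s) : ‖(a i * exp ((μ i - z) * T)) • e i‖
        ≤ C * Real.exp (-((1 - δ) * m * T)) * ‖v‖ * (1 / 2) ^ i := by
      rw [mul_comm (a i), mul_smul, norm_smul, norm_exp]
      have hre : ((μ i - z) * T).re ≤ -((1 - δ) * m * T) + i * (-(2 * m * T)) := by
        simp only [re_mul_ofReal, sub_re, hμ]
        nlinarith
      calc _ ≤ Real.exp (-((1 - δ) * m * T) + i * (-(2 * m * T))) * (C * R ^ i * ‖v‖) := by
            gcongr; exact hcoef i hi
        _ = C * Real.exp (-((1 - δ) * m * T)) * ‖v‖ * (R * Real.exp (-(2 * m * T))) ^ i := by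
            rw [Real.exp_add, Real.exp_nat_mul, mul_pow]; ring
        _ ≤ _ := by gcongr
    calc ‖w T‖ ≤ ∑ i ∈ s, C * Real.exp (-((1 - δ) * m * T)) * ‖v‖ * (1 / 2) ^ i :=
          (norm_sum_le _ _).trans (Finset.sum_le_sum hterm)
      _ = C * Real.exp (-((1 - δ) * m * T)) * ‖v‖ * ∑ i ∈ s, (1 / 2) ^ i := by
          rw [Finset.mul_sum]
      _ ≤ C * Real.exp (-((1 - δ) * m * T)) * ‖v‖ * 2 := by
          gcongr
          exact (summable_geometric_two.sum_le_tsum _ fun i _ => by positivity).trans_eq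
            tsum_geometric_two
      _ = 2 * C * Real.exp (-((1 - δ) * m * T)) * ‖v‖ := by ring
      _ ≤ _ := by gcongr
  have h2 : ‖v‖ ≤ 2 * M * T * ‖g‖ := by
    have := norm_sub_norm_le v (w T)
    rw [hw0, norm_sub_rev] at h1
    nlinarith
  rw [div_mul_eq_mul_div, one_mul, div_le_iff₀ (by positivity)]
  linarith

end Biorthogonal

open scoped SchwartzMap InnerProductSpace

section Schwartz

/-- Multiplication by the variable. -/
noncomputable def schwartzMulX : 𝓢(ℝ, ℂ) →L[ℂ] 𝓢(ℝ, ℂ) :=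
  SchwartzMap.smulLeftCLM ℂ (fun x : ℝ => (x : ℂ))

/-- Differentiation. -/
noncomputable def schwartzD : 𝓢(ℝ, ℂ) →L[ℂ] 𝓢(ℝ, ℂ) := SchwartzMap.derivCLM ℂ ℂ

/-- Pointwise complex conjugation. -/
noncomputable def schwartzConj : 𝓢(ℝ, ℂ) →L[ℝ] 𝓢(ℝ, ℂ) :=
  SchwartzMap.postcompCLM (conjCLE : ℂ →L[ℝ] ℂ)

/-- The class of a Schwartz function in `L²(ℝ)`. -/
noncomputable def schwartzL2 : 𝓢(ℝ, ℂ) →L[ℂ] Lp ℂ 2 (volume : Measure ℝ) :=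
  SchwartzMap.toLpCLM ℂ ℂ 2 volume

/-- The complex harmonic oscillator `-∂² + c x²`. -/
noncomputable def schwartzOsc (c : ℂ) : 𝓢(ℝ, ℂ) →L[ℂ] 𝓢(ℝ, ℂ) :=
  c • schwartzMulX ∘L schwartzMulX - schwartzD ∘L schwartzD

/-- The creation operator `-∂ + γ x`. -/
noncomputable def schwartzCreate (γ : ℂ) : 𝓢(ℝ, ℂ) →L[ℂ] 𝓢(ℝ, ℂ) := γ • schwartzMulX - schwartzD

/-- The annihilation operator `∂ + γ x`. -/
noncomputable def schwartzAnnihilate (γ : ℂ) : 𝓢(ℝ, ℂ) →L[ℂ] 𝓢(ℝ, ℂ) :=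
  γ • schwartzMulX + schwartzD

@[simp]
theorem schwartzMulX_apply (u : 𝓢(ℝ, ℂ)) (x : ℝ) : schwartzMulX u x = x * u x := by
  rw [schwartzMulX, SchwartzMap.smulLeftCLM_apply_apply Function.Complex.hasTemperateGrowth_ofReal,
    smul_eq_mul]

@[simp]
theorem schwartzD_apply (u : 𝓢(ℝ, ℂ)) (x : ℝ) : schwartzD u x = deriv u x := rfl

@[simp]
theorem schwartzConj_apply (u : 𝓢(ℝ, ℂ)) (x : ℝ) : schwartzConj u x = starRingEnd ℂ (u x) := rfl

theorem schwartzD_mulX (u : 𝓢(ℝ, ℂ)) :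
    schwartzD (schwartzMulX u) = schwartzMulX (schwartzD u) + u := by
  ext x
  have h : HasDerivAt (schwartzMulX u) (1 * u x + x * deriv u x) x := by
    rw [show (schwartzMulX u : ℝ → ℂ) = fun x : ℝ => (x : ℂ) * u x from
      funext (schwartzMulX_apply u)]
    exact (ofRealCLM.hasDerivAt (x := x)).mul (u.hasDerivAt x)
  simp [h.deriv]; ring

theorem schwartzConj_conj (u : 𝓢(ℝ, ℂ)) : schwartzConj (schwartzConj u) = u := by
  ext x; simp

theorem schwartzConj_mulX (u : 𝓢(ℝ, ℂ)) :
    schwartzConj (schwartzMulX u) = schwartzMulX (schwartzConj u) := by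
  ext x; simp

theorem schwartzConj_smul (a : ℂ) (u : 𝓢(ℝ, ℂ)) :
    schwartzConj (a • u) = starRingEnd ℂ a • schwartzConj u := by
  ext x; simp

theorem schwartzConj_D (u : 𝓢(ℝ, ℂ)) :
    schwartzConj (schwartzD u) = schwartzD (schwartzConj u) := by
  ext x
  exact ((conjCLE : ℂ →L[ℝ] ℂ).hasFDerivAt.comp_hasDerivAt x (u.hasDerivAt x)).deriv.symm

theorem inner_schwartzL2 (u v : 𝓢(ℝ, ℂ)) :
    ⟪schwartzL2 u, schwartzL2 v⟫_ℂ = ∫ x, schwartzConj u x * v x := by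
  refine (SchwartzMap.inner_toL2_toL2_eq u v).trans ?_
  simp [mul_comm]

theorem norm_schwartzL2 (u : 𝓢(ℝ, ℂ)) : ‖schwartzL2 u‖ = Real.sqrt (∫ x, ‖u x‖ ^ 2) := by
  rw [norm_eq_sqrt_re_inner (𝕜 := ℂ), inner_schwartzL2]
  congr 1
  have : ∀ x, schwartzConj u x * u x = ((‖u x‖ ^ 2 : ℝ) : ℂ) := fun x => by
    rw [schwartzConj_apply, conj_mul']; norm_cast
  simp_rw [this, integral_complex_ofReal]
  simp

theorem norm_schwartzL2_conj (u : 𝓢(ℝ, ℂ)) : ‖schwartzL2 (schwartzConj u)‖ = ‖schwartzL2 u‖ := by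
  rw [norm_schwartzL2, norm_schwartzL2]
  simp

theorem inner_schwartzL2_D_right (u v : 𝓢(ℝ, ℂ)) :
    ⟪schwartzL2 u, schwartzL2 (schwartzD v)⟫_ℂ = -⟪schwartzL2 (schwartzD u), schwartzL2 v⟫_ℂ := by
  simp only [inner_schwartzL2, schwartzConj_D]
  exact SchwartzMap.integral_mul_deriv_eq_neg_deriv_mul (schwartzConj u) v

theorem inner_schwartzL2_mulX_right (u v : 𝓢(ℝ, ℂ)) :
    ⟪schwartzL2 u, schwartzL2 (schwartzMulX v)⟫_ℂ
      = ⟪schwartzL2 (schwartzMulX u), schwartzL2 v⟫_ℂ := by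
  simp only [inner_schwartzL2, schwartzConj_mulX, schwartzMulX_apply]
  congr 1; ext x; ring

/-- The bilinear pairing `∫ u v`, written through the inner product of `L²(ℝ)`. -/
theorem inner_conj_comm (u v : 𝓢(ℝ, ℂ)) :
    ⟪schwartzL2 (schwartzConj u), schwartzL2 v⟫_ℂ
      = ⟪schwartzL2 (schwartzConj v), schwartzL2 u⟫_ℂ := by
  simp only [inner_schwartzL2, schwartzConj_conj, mul_comm]

theorem inner_conj_create (γ : ℂ) (u v : 𝓢(ℝ, ℂ)) :
    ⟪schwartzL2 (schwartzConj (schwartzCreate γ u)), schwartzL2 v⟫_ℂ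
      = ⟪schwartzL2 (schwartzConj u), schwartzL2 (schwartzAnnihilate γ v)⟫_ℂ := by
  simp only [schwartzCreate, schwartzAnnihilate, sub_apply,
    add_apply, smul_apply, map_sub, map_add, map_smul,
    schwartzConj_smul, schwartzConj_mulX, schwartzConj_D, inner_sub_left, inner_add_right,
    inner_smul_left, inner_smul_right, inner_schwartzL2_D_right, inner_schwartzL2_mulX_right,
    conj_conj]
  ring

theorem inner_conj_osc (c : ℂ) (u v : 𝓢(ℝ, ℂ)) :
    ⟪schwartzL2 (schwartzConj (schwartzOsc c u)), schwartzL2 v⟫_ℂ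
      = ⟪schwartzL2 (schwartzConj u), schwartzL2 (schwartzOsc c v)⟫_ℂ := by
  simp only [schwartzOsc, sub_apply, ContinuousLinearMap.comp_apply,
    smul_apply, map_sub, map_smul,
    schwartzConj_smul, schwartzConj_mulX, schwartzConj_D, inner_sub_left, inner_sub_right,
    inner_smul_left, inner_smul_right, inner_schwartzL2_D_right, inner_schwartzL2_mulX_right,
    conj_conj]
  ring

theorem inner_osc_self (c : ℂ) (u : 𝓢(ℝ, ℂ)) :
    ⟪schwartzL2 u, schwartzL2 (schwartzOsc c u)⟫_ℂ
      = (‖schwartzL2 (schwartzD u)‖ : ℂ) ^ 2 + c * (‖schwartzL2 (schwartzMulX u)‖ : ℂ) ^ 2 := by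
  simp only [schwartzOsc, sub_apply, ContinuousLinearMap.comp_apply,
    smul_apply, map_sub, map_smul, inner_sub_right, inner_smul_right,
    inner_schwartzL2_D_right u, inner_schwartzL2_mulX_right u, inner_self_eq_norm_sq_to_K]
  simp; ring

theorem annihilate_create (γ : ℂ) (u : 𝓢(ℝ, ℂ)) :
    schwartzAnnihilate γ (schwartzCreate γ u)
      = schwartzCreate γ (schwartzAnnihilate γ u) + (2 * γ) • u := by
  simp only [schwartzCreate, schwartzAnnihilate, sub_apply,
    add_apply, smul_apply, map_sub, map_add, map_smul,
    schwartzD_mulX]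
  module

theorem osc_eq_create_annihilate (γ : ℂ) (u : 𝓢(ℝ, ℂ)) :
    schwartzOsc (γ ^ 2) u = schwartzCreate γ (schwartzAnnihilate γ u) + γ • u := by
  simp only [schwartzOsc, schwartzCreate, schwartzAnnihilate, sub_apply,
    add_apply, ContinuousLinearMap.comp_apply,
    smul_apply, map_add, map_smul, schwartzD_mulX]
  module

end Schwartz

section Moments

open scoped FourierTransform ContDiff

theorem ae_eq_zero_of_fourier_eq_zero {h : ℝ → ℂ} (hh : Integrable h) (hF : ∀ ξ, 𝓕 h ξ = 0) :
    ∀ᵐ x, h x = 0 := by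
  refine ae_eq_zero_of_integral_contDiff_smul_eq_zero hh.locallyIntegrable
    fun g g_smooth g_cpt => ?_
  have hg₁ : HasCompactSupport (Complex.ofRealCLM ∘ g) := g_cpt.comp_left rfl
  have hg₂ : ContDiff ℝ ∞ (Complex.ofRealCLM ∘ g) := by fun_prop
  set φ : 𝓢(ℝ, ℂ) := hg₁.toSchwartzMap hg₂
  have key : ∫ ξ, 𝓕 h ξ * (𝓕⁻ φ) ξ = ∫ x, h x * 𝓕 (𝓕⁻ φ) x := by
    have := VectorFourier.integral_bilin_fourierIntegral_eq_flip (.mul ℂ ℂ) (L := innerₗ ℝ)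
      Real.continuous_fourierChar continuous_inner hh ((𝓕⁻ φ).integrable (μ := volume))
    rw [flip_innerₗ] at this
    exact this
  rw [FourierTransform.fourier_fourierInv_eq] at key
  simp only [hF, zero_mul, integral_zero] at key
  rw [key]
  congr 1; ext x
  simp [φ, mul_comm]

/-- An exponentially decaying function all of whose moments vanish is zero. -/
theorem ae_eq_zero_of_moments_eq_zero {h : ℝ → ℂ} (hm : AEStronglyMeasurable h)
    (hint : ∀ t : ℝ, Integrable fun x : ℝ => ‖h x‖ * Real.exp (t * |x|))
    (hmom : ∀ n : ℕ, ∫ x : ℝ, (x : ℂ) ^ n * h x = 0) : ∀ᵐ x, h x = 0 := by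
  have hh : Integrable h := by
    have := hint 0
    simp only [zero_mul, Real.exp_zero, mul_one] at this
    exact (integrable_norm_iff hm).1 this
  refine ae_eq_zero_of_fourier_eq_zero hh fun ξ => ?_
  rw [Real.fourier_real_eq_integral_exp_smul]
  set a : ℂ := -2 * Real.pi * ξ * I with ha
  have hsum : HasSum (fun n : ℕ => ∫ x : ℝ, a ^ n / n.factorial * ((x : ℂ) ^ n * h x))
      (∫ x : ℝ, Complex.exp (↑(-2 * Real.pi * x * ξ) * I) • h x) := by
    refine hasSum_integral_of_dominated_convergence
      (fun n x => (‖a‖ * |x|) ^ n / n.factorial * ‖h x‖) (fun n => ?_) (fun n => ?_)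
      (Filter.Eventually.of_forall fun x => ?_) ?_ (Filter.Eventually.of_forall fun x => ?_)
    · exact ((Continuous.aestronglyMeasurable (by fun_prop)).mul hm).const_mul _
    · refine Filter.Eventually.of_forall fun x => le_of_eq ?_
      simp [mul_pow]; ring
    · exact (Real.summable_pow_div_factorial _).mul_right _
    · refine (hint ‖a‖).congr (Filter.Eventually.of_forall fun x => ?_)
      simp only [tsum_mul_right]
      rw [mul_comm, Real.exp_eq_exp_ℝ, NormedSpace.exp_eq_tsum_div]
    · have h1 := (NormedSpace.expSeries_div_hasSum_exp (𝔸 := ℂ) (a * x)).mul_right (h x)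
      rw [← Complex.exp_eq_exp_ℂ] at h1
      rw [smul_eq_mul, show ((-2 * Real.pi * x * ξ : ℝ) : ℂ) * I = a * x by
        rw [ha]; push_cast; ring]
      refine h1.congr_fun fun n => ?_
      rw [mul_pow]; ring
  simp only [integral_const_mul, hmom, mul_zero] at hsum
  exact hsum.unique hasSum_zero

end Moments

section Gaussian

open scoped ContDiff

theorem exists_bound_polynomial_mul_gaussian {γ : ℂ} (hγ : 0 < γ.re) (p : Polynomial ℂ) :
    ∃ C, ∀ x : ℝ, ‖p.eval (x : ℂ) * exp (-(γ / 2 * x ^ 2))‖ ≤ C := by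
  induction p using Polynomial.induction_on' with
  | add p q hp hq =>
    obtain ⟨C, hC⟩ := hp
    obtain ⟨C', hC'⟩ := hq
    refine ⟨C + C', fun x => ?_⟩
    rw [Polynomial.eval_add, add_mul]
    exact norm_add_le_of_le (hC x) (hC' x)
  | monomial n a =>
    set r := γ.re
    refine ⟨‖a‖ * (n.factorial * Real.exp (1 / (2 * r))), fun x => ?_⟩
    have h1 : |x| ^ n ≤ n.factorial * Real.exp |x| := by
      have := Real.pow_div_factorial_le_exp |x| (abs_nonneg x) n
      rwa [div_le_iff₀' (by positivity)] at this
    have h2 : |x| + -(r / 2 * x ^ 2) ≤ 1 / (2 * r) := by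
      rw [← sq_abs x, le_div_iff₀ (by positivity)]
      nlinarith [sq_nonneg (r * |x| - 1)]
    have h3 : (-(γ / 2 * (x : ℂ) ^ 2)).re = -(r / 2 * x ^ 2) := by
      have : -(γ / 2 * (x : ℂ) ^ 2) = ((-(x ^ 2) / 2 : ℝ) : ℂ) * γ := by push_cast; ring
      rw [this, re_ofReal_mul]; ring
    rw [Polynomial.eval_monomial, norm_mul, norm_mul, norm_pow, norm_real, norm_exp, h3,
      Real.norm_eq_abs, mul_assoc]
    refine mul_le_mul_of_nonneg_left ?_ (norm_nonneg a)
    calc |x| ^ n * Real.exp (-(r / 2 * x ^ 2))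
        ≤ n.factorial * Real.exp |x| * Real.exp (-(r / 2 * x ^ 2)) := by gcongr
      _ = n.factorial * Real.exp (|x| + -(r / 2 * x ^ 2)) := by rw [Real.exp_add]; ring
      _ ≤ _ := mul_le_mul_of_nonneg_left (Real.exp_le_exp.2 h2) (by positivity)

theorem hasDerivAt_complex_gaussian (γ : ℂ) (x : ℝ) :
    HasDerivAt (fun x : ℝ => exp (-(γ / 2 * x ^ 2))) (-(γ * x) * exp (-(γ / 2 * x ^ 2))) x := by
  have h : HasDerivAt (fun x : ℝ => -(γ / 2 * (x : ℂ) ^ 2)) (-(γ * x)) x := by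
    have h1 : HasDerivAt (fun x : ℝ => (x : ℂ)) 1 x := ofRealCLM.hasDerivAt
    refine ((h1.pow 2).const_mul (γ / 2)).neg.congr_deriv ?_
    simp; ring
  exact h.cexp.congr_deriv (mul_comm _ _)

theorem exists_iteratedDeriv_complex_gaussian (γ : ℂ) (n : ℕ) :
    ∃ p : Polynomial ℂ, iteratedDeriv n (fun x : ℝ => exp (-(γ / 2 * x ^ 2)))
      = fun x : ℝ => p.eval (x : ℂ) * exp (-(γ / 2 * x ^ 2)) := by
  induction n with
  | zero => exact ⟨1, by simp⟩
  | succ n ih =>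
    obtain ⟨p, hp⟩ := ih
    refine ⟨p.derivative - Polynomial.C γ * Polynomial.X * p, ?_⟩
    ext x
    rw [iteratedDeriv_succ, hp]
    refine (((p.hasDerivAt (x : ℂ)).comp_ofReal).mul
      (hasDerivAt_complex_gaussian γ x)).deriv.trans ?_
    simp; ring

/-- The Gaussian `exp (-γ x² / 2)` as a Schwartz function. -/
noncomputable def schwartzGaussian (γ : ℂ) (hγ : 0 < γ.re) : 𝓢(ℝ, ℂ) where
  toFun x := exp (-(γ / 2 * x ^ 2))
  smooth' := by
    have : ContDiff ℝ ∞ (fun x : ℝ => (x : ℂ)) := ofRealCLM.contDiff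
    fun_prop
  decay' k n := by
    obtain ⟨p, hp⟩ := exists_iteratedDeriv_complex_gaussian γ n
    obtain ⟨C, hC⟩ := exists_bound_polynomial_mul_gaussian hγ (Polynomial.X ^ k * p)
    refine ⟨C, fun x => (hC x).trans' (le_of_eq ?_)⟩
    rw [norm_iteratedFDeriv_eq_norm_iteratedDeriv, hp]
    simp [mul_assoc]

theorem schwartzGaussian_apply {γ : ℂ} (hγ : 0 < γ.re) (x : ℝ) :
    schwartzGaussian γ hγ x = exp (-(γ / 2 * x ^ 2)) := rfl

theorem annihilate_gaussian {γ : ℂ} (hγ : 0 < γ.re) :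
    schwartzAnnihilate γ (schwartzGaussian γ hγ) = 0 := by
  ext x
  have h : deriv (schwartzGaussian γ hγ) x = _ := (hasDerivAt_complex_gaussian γ x).deriv
  simp [schwartzAnnihilate, h, schwartzGaussian_apply]
  ring

theorem inner_conj_gaussian_ne_zero {γ : ℂ} (hγ : 0 < γ.re) :
    ⟪schwartzL2 (schwartzConj (schwartzGaussian γ hγ)),
      schwartzL2 (schwartzGaussian γ hγ)⟫_ℂ ≠ 0 := by
  rw [inner_schwartzL2, schwartzConj_conj]
  have h (x : ℝ) : schwartzGaussian γ hγ x * schwartzGaussian γ hγ x = exp (-γ * x ^ 2) := by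
    rw [schwartzGaussian_apply, ← Complex.exp_add]; ring_nf
  have hγ0 : γ ≠ 0 := by rintro rfl; simp at hγ
  simp_rw [h, integral_gaussian_complex hγ]
  rw [cpow_def_of_ne_zero (div_ne_zero (by exact_mod_cast Real.pi_ne_zero) hγ0)]
  exact exp_ne_zero _

theorem mulX_iterate_apply (u : 𝓢(ℝ, ℂ)) (n : ℕ) (x : ℝ) :
    (schwartzMulX^[n] u) x = x ^ n * u x := by
  induction n with
  | zero => simp
  | succ n ih => rw [Function.iterate_succ_apply', schwartzMulX_apply, ih, pow_succ]; ring

/-- Polynomial multiples of a Gaussian are complete in `L²(ℝ)`. -/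
theorem eq_zero_of_inner_mulX_gaussian_eq_zero {γ : ℂ} (hγ : 0 < γ.re)
    (r : Lp ℂ 2 (volume : Measure ℝ))
    (hr : ∀ n : ℕ, ⟪schwartzL2 (schwartzMulX^[n] (schwartzGaussian γ hγ)), r⟫_ℂ = 0) : r = 0 := by
  set G := schwartzGaussian γ hγ
  have hG (x : ℝ) : ‖G x‖ = Real.exp (-(γ.re / 2 * x ^ 2)) := by
    have : -(γ / 2 * (x : ℂ) ^ 2) = ((-(x ^ 2) / 2 : ℝ) : ℂ) * γ := by push_cast; ring
    rw [schwartzGaussian_apply, norm_exp, this, re_ofReal_mul]; ring_nf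
  have hGm : AEStronglyMeasurable (schwartzConj G) :=
    (schwartzConj G).continuous.aestronglyMeasurable
  have hrm : AEStronglyMeasurable r := Lp.aestronglyMeasurable r
  have hae := ae_eq_zero_of_moments_eq_zero (h := fun x => schwartzConj G x * r x)
    (hGm.mul hrm) (fun t => ?_) fun n => ?_
  · rw [Lp.eq_zero_iff_ae_eq_zero]
    filter_upwards [hae] with x hx
    rcases mul_eq_zero.1 hx with h | h
    · have := hG x
      rw [schwartzConj_apply, map_eq_zero] at h
      rw [h, norm_zero] at this
      exact absurd this (Real.exp_pos _).ne
    · exact h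
  · have h1 : MemLp (fun x : ℝ => ‖G x‖ * Real.exp (t * |x|)) 2 := by
      have hc : Continuous (fun x : ℝ => ‖G x‖ * Real.exp (t * |x|)) := by
        have := G.continuous
        fun_prop
      rw [memLp_two_iff_integrable_sq_norm hc.aestronglyMeasurable]
      refine ((integrable_exp_neg_mul_sq (half_pos hγ)).const_mul
        (Real.exp (2 * t ^ 2 / γ.re))).mono (by fun_prop) (Filter.Eventually.of_forall fun x => ?_)
      rw [hG, ← Real.exp_add, ← Real.exp_add, Real.norm_eq_abs, Real.norm_eq_abs,
        Real.norm_eq_abs, Real.abs_exp, Real.abs_exp, abs_of_pos (by positivity), ← Real.exp_nat_mul,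
        Real.exp_le_exp, ← sub_nonneg]
      have : 2 * t ^ 2 / γ.re + -(γ.re / 2) * x ^ 2 -
          ((2 : ℕ) : ℝ) * (-(γ.re / 2 * x ^ 2) + t * |x|) =
          (γ.re * |x| - 2 * t) ^ 2 / (2 * γ.re) := by
        rw [← sq_abs x]; field_simp; ring
      rw [this]; positivity
    have h2 := h1.integrable_mul (Lp.memLp r).norm
    refine h2.congr (Filter.Eventually.of_forall fun x => ?_)
    simp; ring
  · rw [← hr n]
    have h1 : ⟪schwartzL2 (schwartzMulX^[n] G), r⟫_ℂ
        = ∫ x, starRingEnd ℂ ((schwartzMulX^[n] G) x) * r x := by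
      rw [L2.inner_def]
      refine integral_congr_ae ?_
      filter_upwards [(schwartzMulX^[n] G).coeFn_toLp 2 volume] with x hx
      rw [← hx, RCLike.inner_apply, mul_comm]
      rfl
    rw [h1]
    congr 1; ext x
    rw [mulX_iterate_apply]
    simp [mul_assoc]

end Gaussian

section Eigenfunctions

variable {γ : ℂ} (hγ : 0 < γ.re)

/-- The unnormalised eigenfunctions of `-∂² + γ² x²`. -/
noncomputable def oscEigen (n : ℕ) : 𝓢(ℝ, ℂ) := (schwartzCreate γ)^[n] (schwartzGaussian γ hγ)

theorem oscEigen_succ (n : ℕ) : oscEigen hγ (n + 1) = schwartzCreate γ (oscEigen hγ n) :=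
  Function.iterate_succ_apply' _ _ _

theorem annihilate_oscEigen_zero : schwartzAnnihilate γ (oscEigen hγ 0) = 0 :=
  annihilate_gaussian hγ

theorem annihilate_oscEigen_succ (n : ℕ) :
    schwartzAnnihilate γ (oscEigen hγ (n + 1)) = (2 * (n + 1) * γ) • oscEigen hγ n := by
  induction n with
  | zero =>
    rw [oscEigen_succ, annihilate_create, annihilate_oscEigen_zero]
    simp
  | succ n ih =>
    rw [oscEigen_succ hγ (n + 1), annihilate_create, ih, map_smul, ← oscEigen_succ, ← add_smul]
    congr 1; push_cast; ring

theorem osc_oscEigen (n : ℕ) :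
    schwartzOsc (γ ^ 2) (oscEigen hγ n) = ((2 * n + 1) * γ) • oscEigen hγ n := by
  rw [osc_eq_create_annihilate]
  cases n with
  | zero => simp [annihilate_oscEigen_zero]
  | succ n =>
    rw [annihilate_oscEigen_succ, map_smul, ← oscEigen_succ, ← add_smul]
    congr 1; push_cast; ring

theorem inner_conj_oscEigen_of_lt {n m : ℕ} (h : n < m) :
    ⟪schwartzL2 (schwartzConj (oscEigen hγ m)), schwartzL2 (oscEigen hγ n)⟫_ℂ = 0 := by
  induction n generalizing m with
  | zero =>
    obtain ⟨m, rfl⟩ := Nat.exists_eq_succ_of_ne_zero h.ne'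
    rw [Nat.succ_eq_add_one, oscEigen_succ, inner_conj_create, annihilate_oscEigen_zero]
    simp
  | succ n ih =>
    obtain ⟨m, rfl⟩ := Nat.exists_eq_succ_of_ne_zero (Nat.ne_zero_of_lt h)
    rw [Nat.succ_eq_add_one, oscEigen_succ, inner_conj_create, annihilate_oscEigen_succ, map_smul,
      inner_smul_right, ih (by omega), mul_zero]

theorem inner_conj_oscEigen_of_ne {n m : ℕ} (h : m ≠ n) :
    ⟪schwartzL2 (schwartzConj (oscEigen hγ m)), schwartzL2 (oscEigen hγ n)⟫_ℂ = 0 := by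
  rcases h.lt_or_gt with h | h
  · rw [inner_conj_comm]; exact inner_conj_oscEigen_of_lt hγ h
  · exact inner_conj_oscEigen_of_lt hγ h

theorem inner_conj_oscEigen_self (n : ℕ) :
    ⟪schwartzL2 (schwartzConj (oscEigen hγ n)), schwartzL2 (oscEigen hγ n)⟫_ℂ
      = (2 * γ) ^ n * n.factorial *
        ⟪schwartzL2 (schwartzConj (oscEigen hγ 0)), schwartzL2 (oscEigen hγ 0)⟫_ℂ := by
  induction n with
  | zero => simp
  | succ n ih =>
    rw [oscEigen_succ, inner_conj_create, ← oscEigen_succ, annihilate_oscEigen_succ, map_smul,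
      inner_smul_right, ih, Nat.factorial_succ]
    push_cast; ring

theorem inner_conj_oscEigen_self_ne_zero (n : ℕ) :
    ⟪schwartzL2 (schwartzConj (oscEigen hγ n)), schwartzL2 (oscEigen hγ n)⟫_ℂ ≠ 0 := by
  have hγ0 : γ ≠ 0 := by rintro rfl; simp at hγ
  rw [inner_conj_oscEigen_self]
  exact mul_ne_zero (mul_ne_zero (pow_ne_zero _ (by simpa using hγ0))
    (by exact_mod_cast n.factorial_ne_zero))
    (inner_conj_gaussian_ne_zero hγ)

theorem exists_norm_sq_oscEigen_le (hc : 0 < (γ ^ 2).re) :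
    ∃ K : ℝ, 0 < K ∧ ∀ n, ‖schwartzL2 (oscEigen hγ n)‖ ^ 2
      ≤ K ^ n * n.factorial * ‖schwartzL2 (oscEigen hγ 0)‖ ^ 2 := by
  set k := 2 + 2 * ‖γ‖ ^ 2 / (γ ^ 2).re with hk
  refine ⟨2 * k * γ.re, by positivity, fun n => ?_⟩
  induction n with
  | zero => simp
  | succ n ih =>
    set u := oscEigen hγ n
    have h1 : ‖schwartzL2 (schwartzD u)‖ ^ 2 + (γ ^ 2).re * ‖schwartzL2 (schwartzMulX u)‖ ^ 2
        = (2 * n + 1) * γ.re * ‖schwartzL2 u‖ ^ 2 := by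
      have h := inner_osc_self (γ ^ 2) u
      rw [osc_oscEigen, map_smul, inner_smul_right, inner_self_eq_norm_sq_to_K] at h
      have := congrArg re h
      simp only [coe_algebraMap, ← ofReal_pow, add_re, re_mul_ofReal, ofReal_re] at this
      rw [← this]
      have h3 : ((2 * (n : ℂ) + 1) * γ).re = (2 * n + 1) * γ.re := by
        rw [show (2 * (n : ℂ) + 1) = ((2 * n + 1 : ℝ) : ℂ) by push_cast; ring, re_ofReal_mul]
      rw [h3]
    have h2 : ‖schwartzL2 (oscEigen hγ (n + 1))‖
        ≤ ‖γ‖ * ‖schwartzL2 (schwartzMulX u)‖ + ‖schwartzL2 (schwartzD u)‖ := by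
      rw [oscEigen_succ, schwartzCreate, sub_apply, smul_apply, map_sub, map_smul, ← norm_smul]
      exact norm_sub_le _ _
    set p := ‖schwartzL2 (schwartzD u)‖
    set q := ‖schwartzL2 (schwartzMulX u)‖
    have h3 : 2 * p ^ 2 + 2 * ‖γ‖ ^ 2 * q ^ 2 ≤ k * (p ^ 2 + (γ ^ 2).re * q ^ 2) := by
      have : k * (p ^ 2 + (γ ^ 2).re * q ^ 2) = 2 * p ^ 2 + 2 * ‖γ‖ ^ 2 * q ^ 2 +
          2 * ‖γ‖ ^ 2 / (γ ^ 2).re * p ^ 2 + 2 * (γ ^ 2).re * q ^ 2 := by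
        rw [hk]; field_simp; ring
      rw [this, add_assoc _ (_ * p ^ 2)]
      exact le_add_of_nonneg_right (by positivity)
    have hk0 : 0 < k := by positivity
    calc ‖schwartzL2 (oscEigen hγ (n + 1))‖ ^ 2 ≤ (‖γ‖ * q + p) ^ 2 := by gcongr
      _ ≤ 2 * p ^ 2 + 2 * ‖γ‖ ^ 2 * q ^ 2 := by nlinarith [sq_nonneg (‖γ‖ * q - p)]
      _ ≤ k * ((2 * n + 1) * γ.re * ‖schwartzL2 u‖ ^ 2) := by rw [← h1]; exact h3
      _ ≤ k * ((2 * n + 2) * γ.re * ‖schwartzL2 u‖ ^ 2) := by gcongr; norm_num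
      _ = 2 * k * γ.re * (n + 1) * ‖schwartzL2 u‖ ^ 2 := by ring
      _ ≤ 2 * k * γ.re * (n + 1) * ((2 * k * γ.re) ^ n * n.factorial *
          ‖schwartzL2 (oscEigen hγ 0)‖ ^ 2) := by gcongr
      _ = _ := by rw [Nat.factorial_succ]; push_cast; ring

/-- The spectral projections of the oscillator grow at most geometrically. -/
theorem exists_norm_projection_le (hc : 0 < (γ ^ 2).re) :
    ∃ C R : ℝ, 0 ≤ C ∧ 0 ≤ R ∧ ∀ n,
      ‖schwartzL2 (schwartzConj (oscEigen hγ n))‖ * ‖schwartzL2 (oscEigen hγ n)‖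
        ≤ C * R ^ n *
          ‖⟪schwartzL2 (schwartzConj (oscEigen hγ n)), schwartzL2 (oscEigen hγ n)⟫_ℂ‖ := by
  obtain ⟨K, hK, h⟩ := exists_norm_sq_oscEigen_le hγ hc
  have hγ0 : γ ≠ 0 := by rintro rfl; simp at hγ
  set β := ‖⟪schwartzL2 (schwartzConj (oscEigen hγ 0)), schwartzL2 (oscEigen hγ 0)⟫_ℂ‖ with hβ
  have hβ0 : 0 < β := norm_pos_iff.2 (inner_conj_oscEigen_self_ne_zero hγ 0)
  have hγn : 0 < ‖γ‖ := norm_pos_iff.2 hγ0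
  refine ⟨‖schwartzL2 (oscEigen hγ 0)‖ ^ 2 / β, K / (2 * ‖γ‖), by positivity, by positivity,
    fun n => ?_⟩
  rw [norm_schwartzL2_conj, ← sq, inner_conj_oscEigen_self, norm_mul, ← hβ]
  refine (h n).trans (le_of_eq ?_)
  simp only [norm_mul, norm_pow, norm_natCast, Complex.norm_ofNat, div_pow]
  field_simp

theorem mulX_mem_span_oscEigen {u : 𝓢(ℝ, ℂ)}
    (hu : u ∈ Submodule.span ℂ (Set.range (oscEigen hγ))) :
    schwartzMulX u ∈ Submodule.span ℂ (Set.range (oscEigen hγ)) := by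
  have hγ0 : γ ≠ 0 := by rintro rfl; simp at hγ
  induction hu using Submodule.span_induction with
  | mem u hu =>
    obtain ⟨n, rfl⟩ := hu
    have h : schwartzMulX (oscEigen hγ n) = (2 * γ)⁻¹ •
        (oscEigen hγ (n + 1) + schwartzAnnihilate γ (oscEigen hγ n)) := by
      rw [oscEigen_succ, eq_inv_smul_iff₀ (by simpa using hγ0), schwartzCreate, schwartzAnnihilate]
      simp only [sub_apply, add_apply, smul_apply]
      module
    rw [h]
    refine Submodule.smul_mem _ _ (Submodule.add_mem _ (Submodule.subset_span ⟨_, rfl⟩) ?_)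
    cases n with
    | zero => simp [annihilate_oscEigen_zero]
    | succ n =>
      rw [annihilate_oscEigen_succ]
      exact Submodule.smul_mem _ _ (Submodule.subset_span ⟨_, rfl⟩)
  | zero => simp
  | add u v _ _ hu hv => rw [map_add]; exact Submodule.add_mem _ hu hv
  | smul a u _ hu => rw [map_smul]; exact Submodule.smul_mem _ _ hu

theorem topologicalClosure_span_oscEigen :
    (Submodule.span ℂ (Set.range fun n => schwartzL2 (oscEigen hγ n))).topologicalClosure = ⊤ := by
  rw [Submodule.topologicalClosure_eq_top_iff, Submodule.eq_bot_iff]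
  intro r hr
  refine eq_zero_of_inner_mulX_gaussian_eq_zero hγ r fun n => ?_
  have hspan : schwartzMulX^[n] (schwartzGaussian γ hγ)
      ∈ Submodule.span ℂ (Set.range (oscEigen hγ)) := by
    induction n with
    | zero => exact Submodule.subset_span ⟨0, rfl⟩
    | succ n ih => rw [Function.iterate_succ_apply']; exact mulX_mem_span_oscEigen hγ ih
  refine (Submodule.mem_orthogonal _ r).1 hr _ ?_
  have := Submodule.mem_map_of_mem (f := schwartzL2.toLinearMap) hspan
  rwa [Submodule.map_span, ← Set.range_comp] at this

end Eigenfunctions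

/-- If multiplication by `ω` rotates the numerical range of `-∂² + γ² x²` into the closed left
half-plane, then the resolvent is uniformly bounded on each half-plane
`δ * (ω γ).re ≤ (ω z).re` avoiding the spectrum. -/
theorem exists_osc_lower_bound {γ ω : ℂ} (hγ : 0 < γ.re) (hc : 0 < (γ ^ 2).re) (hω : ω.re ≤ 0)
    (hωc : (ω * γ ^ 2).re ≤ 0) (hωγ : (ω * γ).re < 0) {δ : ℝ} (hδ0 : 0 < δ) (hδ1 : δ < 1) :
    ∃ ε : ℝ, 0 < ε ∧ ∀ z : ℂ, δ * (ω * γ).re ≤ (ω * z).re → ∀ f : 𝓢(ℝ, ℂ),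
      ε * ‖schwartzL2 f‖ ≤ ‖schwartzL2 (schwartzOsc (γ ^ 2) f - z • f)‖ := by
  obtain ⟨C, R, hC, hR, hproj⟩ := exists_norm_projection_le hγ hc
  set m := -(ω * γ).re with hm
  set μ : ℕ → ℂ := fun n => ω * ((2 * n + 1) * γ) with hμdef
  have hμ (n : ℕ) : (μ n).re = -((2 * n + 1) * m) := by
    have : μ n = ((2 * n + 1 : ℝ) : ℂ) * (ω * γ) := by simp only [hμdef]; push_cast; ring
    rw [this, re_ofReal_mul]; ring
  have hdiss (s : Finset ℕ) (a : ℕ → ℂ) : (inner ℂ (∑ i ∈ s, a i • schwartzL2 (oscEigen hγ i))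
      (∑ i ∈ s, (a i * μ i) • schwartzL2 (oscEigen hγ i))).re ≤ 0 := by
    set u := ∑ i ∈ s, a i • oscEigen hγ i with hu
    have h1 : ∑ i ∈ s, a i • schwartzL2 (oscEigen hγ i) = schwartzL2 u := by
      simp only [hu, map_sum, map_smul]
    have h2 : ∑ i ∈ s, (a i * μ i) • schwartzL2 (oscEigen hγ i)
        = ω • schwartzL2 (schwartzOsc (γ ^ 2) u) := by
      simp only [hu, map_sum, map_smul, osc_oscEigen, Finset.smul_sum, smul_smul]
      refine Finset.sum_congr rfl fun i _ => ?_
      congr 1; simp only [hμdef]; ring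
    rw [h1, h2, inner_smul_right, inner_osc_self, mul_add, ← mul_assoc, ← ofReal_pow, ← ofReal_pow,
      add_re, re_mul_ofReal, re_mul_ofReal]
    exact add_nonpos (mul_nonpos_of_nonpos_of_nonneg hω (by positivity))
      (mul_nonpos_of_nonpos_of_nonneg hωc (by positivity))
  have hm0 : 0 < m := by linarith
  obtain ⟨ε, hε, hbound⟩ := exists_uniform_resolvent_bound hm0 hδ0 hδ1 hC hR hμ
    (fun i j hij => inner_conj_oscEigen_of_ne hγ hij) (inner_conj_oscEigen_self_ne_zero hγ) hproj
    hdiss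
  have hω0 : 0 < ‖ω‖ := norm_pos_iff.2 (by rintro rfl; simp at hωγ)
  refine ⟨ε / ‖ω‖, by positivity, fun z hz f => ?_⟩
  set g := schwartzOsc (γ ^ 2) f - z • f with hg
  have hden (i : ℕ) : (2 * i + 1) * γ - z ≠ 0 := fun h => by
    have h1 := congrArg re (congrArg (ω * ·) (sub_eq_zero.1 h))
    have h2 := hμ i
    simp only [hμdef] at h1 h2
    have : (0 : ℝ) ≤ i * m := by positivity
    nlinarith
  have hdual (φ : Lp ℂ 2 (volume : Measure ℝ)) :
      ‖⟪schwartzL2 (schwartzConj f), φ⟫_ℂ‖ ≤ ‖schwartzL2 g‖ * (‖ω‖ / ε) * ‖φ‖ := by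
    have hmem : φ ∈ (Submodule.span ℂ
        (Set.range fun n => schwartzL2 (oscEigen hγ n))).topologicalClosure := by
      rw [topologicalClosure_span_oscEigen]; trivial
    refine closure_minimal (t := {φ : Lp ℂ 2 (volume : Measure ℝ) |
      ‖⟪schwartzL2 (schwartzConj f), φ⟫_ℂ‖ ≤ ‖schwartzL2 g‖ * (‖ω‖ / ε) * ‖φ‖}) (fun φ hφ => ?_)
      (isClosed_le (by fun_prop) (by fun_prop)) hmem
    obtain ⟨b, rfl⟩ := (Finsupp.mem_span_range_iff_exists_finsupp).1 hφ
    set a : ℕ → ℂ := fun i => b i / ((2 * i + 1) * γ - z) with ha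
    set χ := ∑ i ∈ b.support, a i • oscEigen hγ i with hχ
    set φ := b.sum fun i c => c • schwartzL2 (oscEigen hγ i) with hφdef
    have h1 : schwartzL2 (schwartzOsc (γ ^ 2) χ - z • χ) = φ := by
      simp only [hχ, hφdef, Finsupp.sum, map_sum, map_smul, osc_oscEigen, Finset.smul_sum,
        smul_smul, ← Finset.sum_sub_distrib, ← sub_smul]
      refine Finset.sum_congr rfl fun i _ => ?_
      congr 1
      rw [mul_comm z, ← mul_sub, ha, div_mul_cancel₀ _ (hden i)]
    have h2 : ⟪schwartzL2 (schwartzConj f), φ⟫_ℂ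
        = ⟪schwartzL2 (schwartzConj g), schwartzL2 χ⟫_ℂ := by
      rw [← h1, hg]
      simp only [map_sub, map_smul, inner_sub_left, inner_sub_right, schwartzConj_smul,
        inner_smul_left, inner_smul_right, inner_conj_osc, conj_conj]
    have h3 : ε * ‖schwartzL2 χ‖ ≤ ‖ω‖ * ‖φ‖ := by
      have h5 : schwartzL2 χ = ∑ i ∈ b.support, a i • schwartzL2 (oscEigen hγ i) := by
        simp only [hχ, map_sum, map_smul]
      have h6 : ω • φ = ∑ i ∈ b.support, (a i * (μ i - ω * z)) • schwartzL2 (oscEigen hγ i) := by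
        simp only [hφdef, Finsupp.sum, Finset.smul_sum, smul_smul]
        refine Finset.sum_congr rfl fun i _ => ?_
        rw [show μ i - ω * z = ω * ((2 * i + 1) * γ - z) by simp only [hμdef]; ring,
          mul_left_comm, ha, div_mul_cancel₀ _ (hden i)]
      rw [← norm_smul, h5, h6]
      exact hbound (ω * z) (by rw [hm]; linarith) b.support a
    have h4 : ‖schwartzL2 χ‖ ≤ ‖ω‖ / ε * ‖φ‖ := by
      rw [div_mul_eq_mul_div, le_div_iff₀ hε]; linarith
    calc ‖⟪schwartzL2 (schwartzConj f), φ⟫_ℂ‖ ≤ ‖schwartzL2 g‖ * ‖schwartzL2 χ‖ := by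
          rw [h2, ← norm_schwartzL2_conj g]; exact norm_inner_le_norm _ _
      _ ≤ ‖schwartzL2 g‖ * (‖ω‖ / ε * ‖φ‖) := by gcongr
      _ = _ := by ring
  have h := hdual (schwartzL2 (schwartzConj f))
  rw [inner_self_eq_norm_sq_to_K, norm_schwartzL2_conj] at h
  simp only [coe_algebraMap, norm_pow, norm_real, norm_norm] at h
  rcases (norm_nonneg (schwartzL2 f)).eq_or_lt with h0 | h0
  · rw [← h0, mul_zero]; exact norm_nonneg _
  · have h5 : ‖schwartzL2 f‖ ≤ ‖schwartzL2 g‖ * (‖ω‖ / ε) := by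
      refine le_of_mul_le_mul_right ?_ h0
      rwa [← sq]
    rw [div_mul_eq_mul_div, div_le_iff₀ hω0]
    rw [mul_div_assoc', le_div_iff₀ hε] at h5
    linarith

theorem oscShiftedNorm_eq_norm_schwartzL2 (c z : ℂ) (f : 𝓢(ℝ, ℂ)) :
    oscShiftedNorm c z f = ‖schwartzL2 (schwartzOsc c f - z • f)‖ := by
  rw [norm_schwartzL2, oscShiftedNorm]
  congr 2; ext x
  have : deriv (deriv (f : ℝ → ℂ)) x = deriv (schwartzD f) x := rfl
  rw [this]
  simp only [schwartzOsc, sub_apply, smul_apply,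
    ContinuousLinearMap.comp_apply, schwartzMulX_apply, schwartzD_apply, smul_eq_mul]
  congr 2; ring

theorem l2Norm_eq_norm_schwartzL2 (f : 𝓢(ℝ, ℂ)) : l2Norm f = ‖schwartzL2 f‖ :=
  (norm_schwartzL2 f).symm

/-- In the upper half-plane, being to the right of the ray through `c` bounds the argument. -/
theorem arg_mem_Ioo_of_im_pos {c w : ℂ} (hre : 0 < c.re) (him : 0 < c.im) (hw : 0 < w.im)
    (hcw : (starRingEnd ℂ c * w).im < 0) : 0 < w.arg ∧ w.arg < c.arg := by
  have hw0 : w ≠ 0 := by rintro rfl; simp at hw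
  have hc0 : c ≠ 0 := by rintro rfl; simp at him
  have hpos : 0 < w.arg := by
    refine (arg_nonneg_iff.2 hw.le).lt_of_ne fun h => ?_
    exact hw.ne' (arg_eq_zero_iff.1 h.symm).2
  refine ⟨hpos, ?_⟩
  by_contra! hle
  have hsin : (starRingEnd ℂ c * w).im = ‖c‖ * ‖w‖ * Real.sin (w.arg - c.arg) := by
    rw [Real.sin_sub, sin_arg, sin_arg, cos_arg hw0, cos_arg hc0]
    have := norm_pos_iff.2 hw0
    have := norm_pos_iff.2 hc0
    field_simp
    simp; ring
  have : 0 ≤ Real.sin (w.arg - c.arg) := by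
    refine Real.sin_nonneg_of_nonneg_of_le_pi (by linarith) ?_
    have := arg_le_pi w
    have := arg_nonneg_iff.2 him.le
    linarith
  rw [hsin] at hcw
  exact absurd hcw (not_lt.2 (by positivity))

/-- Pseudospectral inclusion near the bottom of the spectrum: for every `0 < δ < 1`
there is `ε > 0` such that for every `z` outside the translated sector
`S(0, arg c) + δ c^{1/2}` and every Schwartz `f`, `‖H_c f - z f‖ ≥ ε ‖f‖`;
equivalently `Spec_ε(H_c) ⊆ S(0, arg c) + δ c^{1/2}`. -/
theorem pseudospectrum_in_translated_sector (c : ℂ) (hre : 0 < c.re) (him : 0 < c.im)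
    (δ : ℝ) (hδ0 : 0 < δ) (hδ1 : δ < 1) :
    ∃ ε : ℝ, 0 < ε ∧ ∀ z : ℂ,
      z ∉ (fun w : ℂ => w + (δ : ℂ) * c ^ ((1 : ℂ) / 2)) ''
          {w : ℂ | 0 < w.arg ∧ w.arg < c.arg} →
      ∀ f : SchwartzMap ℝ ℂ,
        oscShiftedNorm c z (f : ℝ → ℂ) ≥ ε * l2Norm (f : ℝ → ℂ) := by
  have hc0 : c ≠ 0 := by rintro rfl; simp at him
  set γ := c ^ ((1 : ℂ) / 2) with hγdef
  have hsq : γ ^ 2 = c := by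
    rw [hγdef, one_div]; exact cpow_ofNat_inv_pow c 2
  have hγre : 0 < γ.re := by
    have h1 : (log c * (1 / 2)).im = c.arg / 2 := by
      rw [show log c * (1 / 2) = ((1 / 2 : ℝ) : ℂ) * log c by push_cast; ring, im_ofReal_mul,
        log_im]; ring
    rw [hγdef, cpow_def_of_ne_zero hc0, exp_re, h1]
    refine mul_pos (Real.exp_pos _) (Real.cos_pos_of_mem_Ioo ⟨?_, ?_⟩)
    · linarith [neg_pi_lt_arg c]
    · have := (arg_lt_pi_iff (z := c)).2 (Or.inl hre.le)
      linarith
  have hγim : 0 < γ.im := by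
    have : c.im = 2 * γ.re * γ.im := by rw [← hsq, sq, mul_im]; ring
    rw [this] at him
    exact pos_of_mul_pos_right him (by positivity)
  have hcγ : starRingEnd ℂ c * γ = ((normSq γ : ℝ) : ℂ) * starRingEnd ℂ γ := by
    rw [← hsq, map_pow, normSq_eq_conj_mul_self]; ring
  obtain ⟨ε₁, hε₁, h₁⟩ := exists_osc_lower_bound (ω := I) hγre (by rwa [hsq]) (by simp)
    (by rw [hsq]; simpa using him.le) (by simpa using hγim) hδ0 hδ1
  obtain ⟨ε₂, hε₂, h₂⟩ := exists_osc_lower_bound (ω := -I * starRingEnd ℂ c) hγre (by rwa [hsq])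
    (by simpa using him.le) (by rw [hsq, mul_assoc, ← normSq_eq_conj_mul_self]; simp)
    (by
      have : 0 < normSq γ := normSq_pos.2 (by rintro h; simp [h] at hγre)
      rw [mul_assoc, hcγ]
      simpa using mul_pos this hγim) hδ0 hδ1
  rw [hsq] at h₁ h₂
  refine ⟨min ε₁ ε₂, lt_min hε₁ hε₂, fun z hz f => ?_⟩
  rw [oscShiftedNorm_eq_norm_schwartzL2, l2Norm_eq_norm_schwartzL2, ge_iff_le]
  by_cases hz₁ : δ * (I * γ).re ≤ (I * z).re
  · exact (mul_le_mul_of_nonneg_right (min_le_left _ _) (norm_nonneg _)).trans (h₁ z hz₁ f)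
  by_cases hz₂ : δ * (-I * starRingEnd ℂ c * γ).re ≤ (-I * starRingEnd ℂ c * z).re
  · exact (mul_le_mul_of_nonneg_right (min_le_right _ _) (norm_nonneg _)).trans (h₂ z hz₂ f)
  refine absurd ⟨z - δ * γ, arg_mem_Ioo_of_im_pos hre him ?_ ?_, by simp⟩ hz
  · simp at hz₁ ⊢
    linarith
  · simp at hz₂ ⊢
    linarith
end
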